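/- Let P₁ and P₂ be lattice polytopes in ℝⁿ. Then the following are equivalent: (a) every syzygy of (P₁,P₂) is Koszul, i.e. for all lattice polytopes W₁, W₂ with P₁ + W₁ = P₂ + W₂ there exists a lattice polytope T with W₁ = P₂ + T and W₂ = P₁ + T; (b) (P₁,P₂) is a regular sequence, i.e. for all lattice polytopes Q and A with Q + P₂ = P₁ + A there exists a lattice polytope B with Q = P₁ + B. -/

import Mathlib

open Pointwise

/-- A lattice polytope in `ℝⁿ`: the convex hull of a nonempty finite set of points
all of whose coordinates are nonnegative integers. -/
def IsLatticePolytope {n : ℕ} (P : Set (Fin n → ℝ)) : Prop :=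
  ∃ F : Finset (Fin n → ℝ), F.Nonempty ∧ (∀ x ∈ F, ∀ i, ∃ m : ℕ, x i = (m : ℝ)) ∧
    P = convexHull ℝ (F : Set (Fin n → ℝ))

/-- **Rådström cancellation**: a nonempty compact summand can be cancelled from an inclusion of
Minkowski sums when the remaining right-hand summand is closed and convex. -/
theorem IsCompact.subset_of_add_subset_add {E : Type*} [AddCommGroup E] [Module ℝ E]
    [TopologicalSpace E] [IsTopologicalAddGroup E] [ContinuousSMul ℝ E] [LocallyConvexSpace ℝ E]
    {K X Y : Set E} (hK : IsCompact K) (hne : K.Nonempty) (hYconv : Convex ℝ Y)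
    (hYclosed : IsClosed Y) (h : K + X ⊆ K + Y) : X ⊆ Y := by
  intro x hx
  by_contra hxY
  obtain ⟨f, u, hfY, hux⟩ := geometric_hahn_banach_closed_point hYconv hYclosed hxY
  obtain ⟨a, ha, hmax⟩ := hK.exists_isMaxOn hne f.continuous.continuousOn
  obtain ⟨a', ha', y, hy, hay⟩ := h (Set.add_mem_add ha hx)
  have hsum : f a' + f y = f a + f x := by
    simpa only [map_add] using congrArg f hay
  have hle : f a' ≤ f a := hmax ha'
  linarith [hfY y hy]

theorem IsLatticePolytope.nonempty {n : ℕ} {P : Set (Fin n → ℝ)} (hP : IsLatticePolytope P) :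
    P.Nonempty := by
  obtain ⟨F, hF, -, rfl⟩ := hP
  exact hF.to_set.convexHull

theorem IsLatticePolytope.convex {n : ℕ} {P : Set (Fin n → ℝ)} (hP : IsLatticePolytope P) :
    Convex ℝ P := by
  obtain ⟨F, -, -, rfl⟩ := hP
  exact convex_convexHull ℝ _

theorem IsLatticePolytope.isCompact {n : ℕ} {P : Set (Fin n → ℝ)} (hP : IsLatticePolytope P) :
    IsCompact P := by
  obtain ⟨F, -, -, rfl⟩ := hP
  exact F.finite_toSet.isCompact_convexHull ℝ

/-- Koszul property for two polytopes: every syzygy of `(P₁, P₂)` is Koszul if and only if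
`(P₁, P₂)` is a regular sequence. -/
theorem koszul_property_two_polytopes {n : ℕ} (P₁ P₂ : Set (Fin n → ℝ))
    (hP₁ : IsLatticePolytope P₁) (hP₂ : IsLatticePolytope P₂) :
    (∀ W₁ W₂ : Set (Fin n → ℝ), IsLatticePolytope W₁ → IsLatticePolytope W₂ →
      P₁ + W₁ = P₂ + W₂ →
        ∃ T : Set (Fin n → ℝ), IsLatticePolytope T ∧ W₁ = P₂ + T ∧ W₂ = P₁ + T) ↔
    (∀ Q A : Set (Fin n → ℝ), IsLatticePolytope Q → IsLatticePolytope A →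
      Q + P₂ = P₁ + A →
        ∃ B : Set (Fin n → ℝ), IsLatticePolytope B ∧ Q = P₁ + B) := by
  constructor
  · intro koszul Q A hQ hA h
    obtain ⟨T, hT, -, hQT⟩ := koszul A Q hA hQ (by rw [← h, add_comm])
    exact ⟨T, hT, hQT⟩
  · intro regular W₁ W₂ hW₁ hW₂ h
    obtain ⟨B, hB, rfl⟩ := regular W₂ W₁ hW₂ hW₁ (by rw [h, add_comm])
    have hsum : P₁ + W₁ = P₁ + (P₂ + B) := by rw [h, add_left_comm]
    refine ⟨B, hB, Set.Subset.antisymm ?_ ?_, rfl⟩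
    · exact hP₁.isCompact.subset_of_add_subset_add hP₁.nonempty (hP₂.convex.add hB.convex)
        (hP₂.isCompact.add hB.isCompact).isClosed hsum.subset
    · exact hP₁.isCompact.subset_of_add_subset_add hP₁.nonempty hW₁.convex
        hW₁.isCompact.isClosed hsum.superset
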